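/- For all n ≥ 1 and k ≥ 1, the following identity holds in ℚ[x_1,…,x_k,t]: W̃_n^≠(x,t) = Σ_{λ ⊢ n} (−1)^{n−ℓ(λ)} c̃_λ(t) p_λ(x)/z_λ, where W̃_n^≠(x,t) := Σ_w t^{cdes(w)} x_w (sum over Smirnov words w of length n over [k] with w_1 ≠ w_n), c̃_λ(t) := n t A_{ℓ(λ)−1}(t) ∏_{i=1}^{ℓ(λ)} [λ_i]_t if ℓ(λ) > 1, and c̃_{(n)}(t) := n t [n−1]_t. (This is the statement ω W̃_n^≠(x,t) = Σ_{λ⊢n} c̃_λ(t) p_λ(x)/z_λ for the standard involution ω on symmetric functions, rewritten without ω using ω p_λ = (−1)^{n−ℓ(λ)} p_λ.) -/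

import Mathlib

open Finset MvPolynomial Polynomial

attribute [local instance] Classical.propDecidable

noncomputable section

/-- The descent number of a word `w = w₁⋯wₙ` over the alphabet `[k]`:
the number of indices `i ∈ [n-1]` with `wᵢ > wᵢ₊₁`. -/
def desc {n k : ℕ} (w : Fin n → Fin k) : ℕ :=
  (Finset.univ.filter fun i : Fin n =>
    ∃ h : (i : ℕ) + 1 < n, w ⟨(i : ℕ) + 1, h⟩ < w i).card

/-- The cyclic descent number: the number of indices `i ∈ [n]` with `wᵢ > wᵢ₊₁`,
where `wₙ₊₁ := w₁`. -/
def cdesc {n k : ℕ} (w : Fin n → Fin k) : ℕ :=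
  (Finset.univ.filter fun i : Fin n =>
    w ⟨((i : ℕ) + 1) % n, Nat.mod_lt _ i.pos⟩ < w i).card

/-- A word is Smirnov if no two adjacent letters are equal. -/
def IsSmirnov {n k : ℕ} (w : Fin n → Fin k) : Prop :=
  ∀ i : Fin n, ∀ h : (i : ℕ) + 1 < n, w ⟨(i : ℕ) + 1, h⟩ ≠ w i

/-- the first letter is strictly smaller than the last letter -/
def FirstLtLast {n k : ℕ} (w : Fin n → Fin k) : Prop :=
  ∃ h : 0 < n, w ⟨0, h⟩ < w ⟨n - 1, Nat.sub_lt h Nat.one_pos⟩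

/-- the first letter is strictly larger than the last letter -/
def FirstGtLast {n k : ℕ} (w : Fin n → Fin k) : Prop :=
  ∃ h : 0 < n, w ⟨n - 1, Nat.sub_lt h Nat.one_pos⟩ < w ⟨0, h⟩

/-- the first letter equals the last letter -/
def FirstEqLast {n k : ℕ} (w : Fin n → Fin k) : Prop :=
  ∃ h : 0 < n, w ⟨0, h⟩ = w ⟨n - 1, Nat.sub_lt h Nat.one_pos⟩

/-- the first letter differs from the last letter -/
def FirstNeLast {n k : ℕ} (w : Fin n → Fin k) : Prop :=
  ∃ h : 0 < n, w ⟨0, h⟩ ≠ w ⟨n - 1, Nat.sub_lt h Nat.one_pos⟩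

/-- the monomial `x_w = x_{w₁}⋯x_{wₙ}` -/
def xw (R : Type) [CommRing R] {n k : ℕ} (w : Fin n → Fin k) : MvPolynomial (Fin k) R :=
  ∏ i, MvPolynomial.X (w i)

/-- Generic restricted Smirnov word enumerator: the sum of `t^(stat w) · x_w` over all
Smirnov words `w` of length `n` over `[k]` satisfying `P`, as a polynomial in `t`
with coefficients in `R[x₁,…,x_k]`. -/
def smirnovEnum (R : Type) [CommRing R] (n k : ℕ) (stat : (Fin n → Fin k) → ℕ)
    (P : (Fin n → Fin k) → Prop) : Polynomial (MvPolynomial (Fin k) R) :=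
  ∑ w ∈ Finset.univ.filter (fun w : Fin n → Fin k => IsSmirnov w ∧ P w),
    Polynomial.X ^ stat w * Polynomial.C (xw R w)

/-- the t-analogue `[m]_t = 1 + t + ⋯ + t^(m-1)`, as a polynomial in `t = Polynomial.X`
with coefficients in `R[x₁,…,x_k]` -/
def tnum (R : Type) [CommRing R] (k m : ℕ) : Polynomial (MvPolynomial (Fin k) R) :=
  ∑ j ∈ Finset.range m, Polynomial.X ^ j

/-- `D(x,t,z) = 1 - Σ_{i≥2} t[i-1]_t e_i(x) z^i`, a formal power series in `z` whose
coefficients are polynomials in `t` with coefficients in `R[x₁,…,x_k]`. -/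
def Dser (R : Type) [CommRing R] (k : ℕ) : PowerSeries (Polynomial (MvPolynomial (Fin k) R)) :=
  PowerSeries.mk fun i =>
    if i = 0 then 1
    else if i = 1 then 0
    else -(Polynomial.X * tnum R k (i - 1) * Polynomial.C (esymm (Fin k) R i))

/-- `Des_{≥2}(σ) = {i ∈ [n-1] : σ(i) - σ(i+1) ≥ 2}`, recorded via 0-based gap positions:
gap `g ∈ {0,…,n-2}` corresponds to the adjacent pair `(σ g, σ (g+1))`. -/
def Des2 {n : ℕ} (σ : Equiv.Perm (Fin n)) : Finset ℕ :=
  (Finset.range n).filter fun g =>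
    ∃ h : g + 1 < n, (σ ⟨g + 1, h⟩ : ℕ) + 2 ≤ (σ ⟨g, Nat.lt_of_succ_lt h⟩ : ℕ)

/-- `Asc_{≥2}(σ) = {i ∈ [n-1] : σ(i+1) - σ(i) ≥ 2}`, recorded via 0-based gap positions. -/
def Asc2 {n : ℕ} (σ : Equiv.Perm (Fin n)) : Finset ℕ :=
  (Finset.range n).filter fun g =>
    ∃ h : g + 1 < n, (σ ⟨g, Nat.lt_of_succ_lt h⟩ : ℕ) + 2 ≤ (σ ⟨g + 1, h⟩ : ℕ)

/-- `maj_{≥2}(σ) = Σ i` over the (1-based) positions `i ∈ [n-1]` with `σ(i+1) - σ(i) ≥ 2`;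
a 0-based gap `g` corresponds to the 1-based position `g + 1`. -/
def maj2 {n : ℕ} (σ : Equiv.Perm (Fin n)) : ℕ :=
  ∑ g ∈ Asc2 σ, (g + 1)

/-- The Eulerian polynomial `A_m(t) = Σ_{σ ∈ S_m} t^{des σ}`. -/
def Eul (R : Type) [CommRing R] (m : ℕ) : Polynomial R :=
  ∑ σ : Equiv.Perm (Fin m), Polynomial.X ^ desc ⇑σ

/-- `z_λ = ∏_i i^{m_i} m_i!` where `m_i` is the number of parts of `λ` equal to `i` -/
def zlam {n : ℕ} (μ : n.Partition) : ℕ :=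
  ∏ i ∈ μ.parts.toFinset, i ^ μ.parts.count i * (μ.parts.count i).factorial

/-- the coefficient `c̃_λ(t)` of `p_λ/z_λ` in `ω W̃_n^≠`:
`c̃_{(n)}(t) = n t [n-1]_t` and, for `ℓ(λ) ≥ 2`,
`c̃_λ(t) = n t A_{ℓ(λ)-1}(t) ∏_i [λ_i]_t`. -/
def cne (k n : ℕ) (μ : n.Partition) : Polynomial (MvPolynomial (Fin k) ℚ) :=
  if μ.parts.card = 1 then
    (n : Polynomial (MvPolynomial (Fin k) ℚ)) * Polynomial.X * tnum ℚ k (n - 1)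
  else
    (n : Polynomial (MvPolynomial (Fin k) ℚ)) * Polynomial.X *
      Eul (MvPolynomial (Fin k) ℚ) (μ.parts.card - 1) * (μ.parts.map (tnum ℚ k)).prod

lemma derivation_prod {R A ι : Type*} [CommRing R] [CommRing A] [Algebra R A] [DecidableEq ι]
    (d : Derivation R A A) (s : Finset ι) (f : ι → A) :
    d (∏ i ∈ s, f i) = ∑ i ∈ s, d (f i) * ∏ j ∈ s.erase i, f j := by
  induction s using Finset.induction_on with
  | empty => simp
  | insert a s ha ih =>
    rw [Finset.prod_insert ha, Derivation.leibniz, ih, Finset.sum_insert ha,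
      Finset.erase_insert ha, smul_eq_mul, smul_eq_mul, add_comm, Finset.mul_sum]
    congr 1
    · ring
    · apply Finset.sum_congr rfl
      intro i hi
      have hia : a ≠ i := fun h => ha (h ▸ hi)
      rw [Finset.erase_insert_of_ne hia, Finset.prod_insert (fun h => ha (Finset.mem_of_mem_erase h))]
      ring

/-- Jacobi's formula for a derivation. -/
lemma jacobi_formula {R A ι : Type*} [CommRing R] [CommRing A] [Algebra R A]
    [DecidableEq ι] [Fintype ι]
    (d : Derivation R A A) (M : Matrix ι ι A) :
    d M.det = (M.adjugate * M.map d).trace := by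
  have h : ∀ i, (M.adjugate * M.map d) i i = (M.updateCol i (fun j => d (M j i))).det := by
    intro i
    rw [← Matrix.cramer_apply, Matrix.cramer_eq_adjugate_mulVec]
    rfl
  simp only [Matrix.trace, Matrix.diag, h]
  simp only [Matrix.det_apply', map_sum]
  rw [Finset.sum_comm]
  apply Finset.sum_congr rfl
  intro σ _
  rw [← zsmul_eq_mul, map_zsmul, zsmul_eq_mul, derivation_prod, Finset.mul_sum]
  apply Finset.sum_congr rfl
  intro i _
  congr 1
  rw [← Finset.mul_prod_erase _ _ (Finset.mem_univ i)]
  congr 1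
  · simp
  · apply Finset.prod_congr rfl
    intro j hj
    rw [Matrix.updateCol_ne (Finset.ne_of_mem_erase hj)]

/-- `1 - z M` -/
def resM {S : Type*} [CommRing S] {k : ℕ} (M : Matrix (Fin k) (Fin k) S) :
    Matrix (Fin k) (Fin k) (PowerSeries S) :=
  1 - (PowerSeries.X : PowerSeries S) • M.map (PowerSeries.C (R := S))

lemma resM_det_const {S : Type*} [CommRing S] {k : ℕ} (M : Matrix (Fin k) (Fin k) S) :
    PowerSeries.constantCoeff (resM M).det = 1 := by
  rw [RingHom.map_det]
  have : (PowerSeries.constantCoeff (R := S)).mapMatrix (resM M) = 1 := by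
    ext i j
    simp [resM, Matrix.one_apply]
  rw [this, Matrix.det_one]

/-- `D' = -D ∑ tr(M^{n+1}) z^n` -/
lemma resM_det_deriv {S : Type*} [CommRing S] {k : ℕ} (M : Matrix (Fin k) (Fin k) S) :
    PowerSeries.derivative S (resM M).det =
      - ((resM M).det * PowerSeries.mk fun n => (M ^ (n + 1)).trace) := by
  set G : Matrix (Fin k) (Fin k) (PowerSeries S) :=
    Matrix.of fun i j => PowerSeries.mk fun n => (M ^ n) i j with hG
  have h1 : resM M * G = 1 := by
    ext i j n
    rw [resM, Matrix.sub_mul, Matrix.one_mul, Matrix.smul_mul, Matrix.sub_apply,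
      Matrix.smul_apply, smul_eq_mul, Matrix.mul_apply, map_sub]
    rcases n with _ | n
    · simp [hG, Matrix.one_apply]
    · rw [PowerSeries.coeff_succ_X_mul]
      simp [hG, pow_succ', Matrix.mul_apply, Matrix.one_apply]
      split_ifs <;> simp [PowerSeries.coeff_one]
  have h2 : (resM M).adjugate = (resM M).det • G := by
    calc (resM M).adjugate = (resM M).adjugate * (resM M * G) := by rw [h1, mul_one]
      _ = _ := by rw [← mul_assoc, Matrix.adjugate_mul, Matrix.smul_mul, one_mul]
  have h3 : (resM M).map (PowerSeries.derivative S) = - M.map (PowerSeries.C (R := S)) := by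
    ext1 i j
    simp only [resM, Matrix.map_apply, Matrix.sub_apply, Matrix.smul_apply, smul_eq_mul, map_sub,
      Derivation.leibniz, PowerSeries.derivative_C, PowerSeries.derivative_X, Matrix.neg_apply,
      Matrix.one_apply]
    split_ifs <;> simp
  rw [jacobi_formula, h2, h3, Matrix.smul_mul, Matrix.trace_smul, Matrix.mul_neg, Matrix.trace_neg,
    smul_eq_mul, mul_neg]
  congr 2
  ext n
  simp [Matrix.trace, Matrix.mul_apply, hG, pow_succ]

/-- transfer matrix -/
def trM {S : Type*} [CommRing S] {k : ℕ} (t : S) (x : Fin k → S) : Matrix (Fin k) (Fin k) S :=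
  Matrix.of fun i j => if j < i then t * x i else if i < j then x i else 0

/-- `∏ (1 + x_i z)` -/
def Eser {S : Type*} [CommRing S] {k : ℕ} (x : Fin k → S) : PowerSeries S :=
  ∏ i, (1 + PowerSeries.X * PowerSeries.C (x i))

lemma det_trM {S : Type*} [CommRing S] {k : ℕ} (t : S) (x : Fin k → S) :
    (PowerSeries.C t - 1) * (resM (trM t x)).det =
      PowerSeries.C t * Eser x - Eser (fun i => t * x i) := by
  set A := resM (trM t x) with hA
  have hu : IsUnit A.det := by
    rw [PowerSeries.isUnit_iff_constantCoeff, hA, resM_det_const]; exact isUnit_one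
  set u : Fin k → PowerSeries S := fun i => PowerSeries.X * PowerSeries.C (x i) with hu'
  set v : Fin k → PowerSeries S := fun _ => 1
  obtain ⟨c, hc⟩ : ∃ c, ∀ s : PowerSeries S,
      (A + Matrix.of fun i _ => s * u i).det = A.det + s * c := by
    refine ⟨A.det * (Matrix.replicateRow Unit v * A⁻¹ * Matrix.replicateCol Unit u) () (), ?_⟩
    intro s
    have := Matrix.det_add_replicateCol_mul_replicateRow (ι := Unit) hu (s • u) v
    have e : Matrix.replicateCol Unit (s • u) * Matrix.replicateRow Unit v =
        Matrix.of fun i _ => s * u i := by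
      ext i j; simp [Matrix.mul_apply, v]
    rw [e] at this
    rw [this, Matrix.det_unique (n := Unit), Matrix.replicateCol_smul, Matrix.mul_smul, Matrix.add_apply,
      Matrix.smul_apply, Matrix.one_apply_eq, smul_eq_mul, PUnit.default_eq_unit]
    ring
  have h1 : A.det + 1 * c = Eser x := by
    rw [← hc, Matrix.det_of_isLowerTriangular, Eser]
    · apply Finset.prod_congr rfl
      intro i _
      simp [hA, resM, trM, hu']
    · intro i j hij
      have hij' : i < j := hij
      simp [hA, resM, trM, hu', hij', hij'.ne, hij'.not_gt]
  have h2 : A.det + PowerSeries.C t * c = Eser (fun i => t * x i) := by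
    rw [← hc, Matrix.det_of_isUpperTriangular, Eser]
    · apply Finset.prod_congr rfl
      intro i _
      simp [hA, resM, trM, hu']
      ring
    · intro i j hij
      have hij' : j < i := hij
      simp [hA, resM, trM, hu', hij', hij'.ne']
      ring
  rw [← h1, ← h2]; ring

lemma Eser_const {S : Type*} [CommRing S] {k : ℕ} (x : Fin k → S) :
    PowerSeries.constantCoeff (Eser x) = 1 := by
  simp [Eser, map_prod]

/-- `P = ∑ (-1)^r p_{r+1} z^r` -/
def Pser {S : Type*} [CommRing S] {k : ℕ} (x : Fin k → S) : PowerSeries S :=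
  PowerSeries.mk fun r => (-1) ^ r * ∑ i, x i ^ (r + 1)

lemma Eser_deriv {S : Type*} [CommRing S] {k : ℕ} (x : Fin k → S) :
    PowerSeries.derivative S (Eser x) = Pser x * Eser x := by
  have hP : Pser x = ∑ i, PowerSeries.mk fun r => (-1) ^ r * x i ^ (r + 1) := by
    ext r; simp [Pser, Finset.mul_sum]
  rw [Eser, derivation_prod, hP, Finset.sum_mul]
  apply Finset.sum_congr rfl
  intro i _
  rw [← Finset.mul_prod_erase _ _ (Finset.mem_univ i), ← mul_assoc]
  congr 1
  ext n
  rw [mul_add, mul_one, mul_comm _ (PowerSeries.X * _), mul_assoc]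
  rcases n with _ | n
  · simp
  · rw [map_add (PowerSeries.derivative S), map_add, map_add, PowerSeries.coeff_succ_X_mul]
    simp
    ring

lemma matrix_pow_entry {S : Type*} [CommRing S] {k : ℕ} (M : Matrix (Fin k) (Fin k) S) (n : ℕ) :
    ∀ i j : Fin k, (M ^ (n + 1)) i j = ∑ w : Fin n → Fin k,
      ∏ l : Fin (n + 1), M ((Fin.cons i w : Fin (n + 1) → Fin k) l)
        ((Fin.snoc w j : Fin (n + 1) → Fin k) l) := by
  induction n with
  | zero =>
    intro i j
    simp [Fin.snoc]
  | succ n ih =>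
    intro i j
    rw [pow_succ', Matrix.mul_apply,
      ← (Fin.consEquiv (fun _ : Fin (n + 1) => Fin k)).sum_comp, Fintype.sum_prod_type]
    apply Finset.sum_congr rfl
    intro a _
    rw [ih, Finset.mul_sum]
    apply Finset.sum_congr rfl
    intro w _
    conv_rhs => rw [Fin.prod_univ_succ]
    have h : (Fin.snoc (Fin.cons a w : Fin (n + 1) → Fin k) j : Fin (n + 2) → Fin k) =
        Fin.cons a (Fin.snoc w j : Fin (n + 1) → Fin k) := by
      rw [Fin.cons_snoc_eq_snoc_cons]
    simp [Fin.consEquiv, h]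

lemma matrix_trace_pow {S : Type*} [CommRing S] {k : ℕ} (M : Matrix (Fin k) (Fin k) S) (n : ℕ) :
    (M ^ (n + 1)).trace = ∑ w : Fin (n + 1) → Fin k,
      ∏ l : Fin (n + 1), M (w l) (w ⟨((l : ℕ) + 1) % (n + 1), Nat.mod_lt _ l.pos⟩) := by
  rw [Matrix.trace, ← (Fin.consEquiv (fun _ : Fin (n + 1) => Fin k)).sum_comp,
    Fintype.sum_prod_type]
  apply Finset.sum_congr rfl
  intro i _
  rw [Matrix.diag, matrix_pow_entry]
  apply Finset.sum_congr rfl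
  intro w _
  apply Finset.prod_congr rfl
  intro l _
  congr 1
  simp only [Fin.consEquiv, Equiv.coe_fn_mk]
  refine Fin.lastCases ?_ (fun l => ?_) l
  · have : (⟨((Fin.last n : Fin (n + 1)) + 1) % (n + 1), Nat.mod_lt _ (Fin.pos (Fin.last n))⟩ :
        Fin (n + 1)) = 0 := by
      ext; simp
    rw [this]; simp
  · have : (⟨((l.castSucc : Fin (n + 1)) + 1) % (n + 1), Nat.mod_lt _ (Fin.pos l.castSucc)⟩ :
        Fin (n + 1)) = l.succ := by
      ext; simp
    rw [this]; simp

lemma smirnov_eq_trace (n k : ℕ) :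
    smirnovEnum ℚ (n + 1) k cdesc FirstNeLast =
      ((trM (Polynomial.X : Polynomial (MvPolynomial (Fin k) ℚ))
        (fun i => Polynomial.C (MvPolynomial.X i))) ^ (n + 1)).trace := by
  rw [matrix_trace_pow, smirnovEnum, Finset.sum_filter]
  apply Finset.sum_congr rfl
  intro w _
  have hiff : (IsSmirnov w ∧ FirstNeLast w) ↔
      ∀ l : Fin (n + 1), w ⟨((l : ℕ) + 1) % (n + 1), Nat.mod_lt _ l.pos⟩ ≠ w l := by
    constructor
    · rintro ⟨h1, _, h2⟩ l
      by_cases hl : (l : ℕ) + 1 < n + 1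
      · have := h1 l hl
        simpa only [Nat.mod_eq_of_lt hl] using this
      · have hl' : (l : ℕ) + 1 = n + 1 := by omega
        simp only [hl', Nat.mod_self]
        convert h2 using 2
        ext; simp; omega
    · intro h
      refine ⟨fun i hi => ?_, Nat.succ_pos n, ?_⟩
      · have := h i
        simpa only [Nat.mod_eq_of_lt hi] using this
      · have := h (Fin.last n)
        simpa [Fin.last] using this
  split_ifs with hc
  · rw [hiff] at hc
    have : ∀ l : Fin (n + 1), trM (Polynomial.X : Polynomial (MvPolynomial (Fin k) ℚ))
        (fun i => Polynomial.C (MvPolynomial.X i)) (w l)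
          (w ⟨((l : ℕ) + 1) % (n + 1), Nat.mod_lt _ l.pos⟩) =
        (if w ⟨((l : ℕ) + 1) % (n + 1), Nat.mod_lt _ l.pos⟩ < w l then Polynomial.X else 1) *
          Polynomial.C (MvPolynomial.X (w l)) := by
      intro l
      rcases lt_or_gt_of_ne (hc l) with h | h
      · simp [trM, h]
      · simp [trM, h, h.not_gt]
    simp only [this, Finset.prod_mul_distrib]
    congr 1
    · rw [Finset.prod_ite, Finset.prod_const, Finset.prod_const_one, mul_one, cdesc]
    · rw [xw, map_prod]
  · rw [hiff] at hc
    push Not at hc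
    obtain ⟨l, hl⟩ := hc
    symm
    apply Finset.prod_eq_zero (Finset.mem_univ l)
    simp [trM, hl]

lemma desc_eq_sum {n k : ℕ} (w : Fin (n + 1) → Fin k) :
    desc w = ∑ l : Fin n, if w l.succ < w l.castSucc then 1 else 0 := by
  rw [desc, Finset.card_filter, Fin.sum_univ_castSucc]
  have : ¬ ∃ h : ((Fin.last n : Fin (n + 1)) : ℕ) + 1 < n + 1,
      w ⟨((Fin.last n : Fin (n + 1)) : ℕ) + 1, h⟩ < w (Fin.last n) := by
    rintro ⟨h, _⟩
    simp at h
  rw [if_neg this, add_zero]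
  apply Finset.sum_congr rfl
  intro l _
  congr 1
  apply propext
  constructor
  · rintro ⟨_, h⟩; exact h
  · intro h; exact ⟨by simp, h⟩

/-- insert `j` in front of a permutation -/
def consPerm {m : ℕ} (p : Fin (m + 1) × Equiv.Perm (Fin m)) : Equiv.Perm (Fin (m + 1)) :=
  ((finSuccEquiv' 0).trans (Equiv.optionCongr p.2)).trans (finSuccEquiv' p.1).symm

lemma consPerm_zero {m : ℕ} (p : Fin (m + 1) × Equiv.Perm (Fin m)) : consPerm p 0 = p.1 := by
  simp [consPerm]

lemma consPerm_succ {m : ℕ} (p : Fin (m + 1) × Equiv.Perm (Fin m)) (i : Fin m) :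
    consPerm p i.succ = p.1.succAbove (p.2 i) := by
  have : finSuccEquiv' (0 : Fin (m + 1)) i.succ = some i := by
    rw [← Fin.succAbove_zero, finSuccEquiv'_succAbove]
  simp [consPerm, this]

lemma consPerm_bij (m : ℕ) : Function.Bijective (consPerm (m := m)) := by
  rw [Fintype.bijective_iff_injective_and_card]
  constructor
  · rintro ⟨j, τ⟩ ⟨j', τ'⟩ h
    have h0 : j = j' := by
      have := congrArg (fun σ : Equiv.Perm (Fin (m + 1)) => σ 0) h
      simpa [consPerm_zero] using this
    subst h0
    congr 1
    ext1 i
    have := congrArg (fun σ : Equiv.Perm (Fin (m + 1)) => σ i.succ) h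
    simpa [consPerm_succ] using this
  · simp [Fintype.card_perm, Nat.factorial_succ]

lemma desc_consPerm {m : ℕ} (p : Fin (m + 2) × Equiv.Perm (Fin (m + 1))) :
    desc ⇑(consPerm p) = (if (p.2 0).castSucc < p.1 then 1 else 0) + desc ⇑p.2 := by
  rw [desc_eq_sum, desc_eq_sum, Fin.sum_univ_succ]
  congr 1
  · rw [Fin.castSucc_zero, consPerm_zero, consPerm_succ]
    congr 1
    apply propext
    exact Fin.succAbove_lt_iff_castSucc_lt _ _
  · apply Finset.sum_congr rfl
    intro l _
    rw [Fin.castSucc_succ, consPerm_succ, consPerm_succ]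
    congr 1
    apply propext
    simp

/-- refined Eulerian polynomials -/
def refE {S : Type*} [CommRing S] (t : S) : ℕ → ℕ → S
  | 0, _ => 1
  | m + 1, j => ∑ i ∈ Finset.range (m + 1), (if i < j then t else 1) * refE t m i

lemma refE_perm (R : Type) [CommRing R] (m : ℕ) : ∀ f : Fin (m + 1) → Polynomial R,
    ∑ σ : Equiv.Perm (Fin (m + 1)), f (σ 0) * Polynomial.X ^ desc ⇑σ =
      ∑ j : Fin (m + 1), f j * refE Polynomial.X m j := by
  induction m with
  | zero =>
    intro f
    simp [desc_eq_sum, refE]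
  | succ m ih =>
    intro f
    rw [← (Equiv.ofBijective _ (consPerm_bij (m + 1))).sum_comp, Fintype.sum_prod_type]
    apply Finset.sum_congr rfl
    intro j _
    simp only [Equiv.ofBijective_apply, desc_consPerm, consPerm_zero]
    rw [← Finset.mul_sum]
    congr 1
    have := ih (fun i => if i.castSucc < j then Polynomial.X else 1)
    rw [refE, Finset.sum_range]
    convert this using 1
    · apply Finset.sum_congr rfl
      intro τ _
      rw [pow_add]
      congr 1
      split_ifs <;> simp
    · rfl

lemma Eul_eq_refE (R : Type) [CommRing R] (m : ℕ) : Eul R m = refE Polynomial.X m 0 := by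
  rcases m with _ | m
  · simp [Eul, desc, refE]
  · have := refE_perm R m (fun _ => 1)
    simp only [one_mul] at this
    rw [Eul, this, refE, Finset.sum_range]
    simp

lemma refE_expand {S : Type*} [CommRing S] (t : S) (j : ℕ) : ∀ m, j ≤ m →
    refE t m j = ∑ l ∈ Finset.range (j + 1), (j.choose l : S) * (t - 1) ^ l * refE t (m - l) 0 := by
  induction j with
  | zero => intro m _; simp
  | succ j ih =>
    intro m hm
    obtain ⟨m, rfl⟩ : ∃ m', m = m' + 1 := ⟨m - 1, by omega⟩
    have hd : refE t (m + 1) (j + 1) = refE t (m + 1) j + (t - 1) * refE t m j := by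
      rw [refE, refE, ← sub_eq_iff_eq_add', ← Finset.sum_sub_distrib,
        Finset.sum_eq_single j]
      · simp; ring
      · intro i _ hi
        have : i < j + 1 ↔ i < j := by omega
        simp [this]
      · intro h; simp at h; omega
    rw [hd, ih _ (by omega), ih _ (by omega), Finset.sum_range_succ' _ (j + 1)]
    simp only [Nat.choose_succ_succ, Nat.cast_add, add_mul, Finset.sum_add_distrib]
    rw [Finset.mul_sum]
    have h2 : ∑ l ∈ Finset.range (j + 1), ((j.choose (l + 1) : ℕ) : S) * (t - 1) ^ (l + 1) *
        refE t (m + 1 - (l + 1)) 0 + (((j + 1).choose 0 : ℕ) : S) * (t - 1) ^ 0 *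
          refE t (m + 1 - 0) 0 = ∑ l ∈ Finset.range (j + 1), (j.choose l : S) * (t - 1) ^ l *
            refE t (m + 1 - l) 0 := by
      rw [Finset.sum_range_succ, Finset.sum_range_succ' _ j]
      simp
    rw [← h2]
    have h3 : ∀ l, m + 1 - (l + 1) = m - l := by intro l; omega
    simp only [h3]
    have h4 : ∑ i ∈ Finset.range (j + 1), (t - 1) * ((j.choose i : S) * (t - 1) ^ i * refE t (m - i) 0)
      = ∑ i ∈ Finset.range (j + 1), (j.choose i : S) * (t - 1) ^ (i + 1) * refE t (m - i) 0 := by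
      apply Finset.sum_congr rfl; intro i _; ring
    rw [h4]
    ring

lemma refE_rec {S : Type*} [CommRing S] (t : S) (m : ℕ) :
    t * refE t (m + 1) 0 = ∑ l ∈ Finset.range (m + 2),
      ((m + 1).choose l : S) * (t - 1) ^ l * refE t (m + 1 - l) 0 := by
  rw [← refE_expand t (m + 1) (m + 1) le_rfl, refE, refE, Finset.mul_sum]
  apply Finset.sum_congr rfl
  intro i hi
  simp at hi
  simp [hi]

/-- The exponential generating function of the Eulerian polynomials. -/
def Aser {S : Type*} [CommRing S] [Algebra ℚ S] (t : S) : PowerSeries S :=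
  PowerSeries.mk fun m => algebraMap ℚ S (1 / (m.factorial : ℚ)) * refE t m 0

lemma Aser_eq {S : Type*} [CommRing S] [Algebra ℚ S] (t : S) :
    PowerSeries.C t * Aser t - PowerSeries.C (t - 1) =
      PowerSeries.rescale (t - 1) (PowerSeries.exp S) * Aser t := by
  ext m
  rcases m with _ | m
  · simp [Aser, refE]
    rw [← PowerSeries.coeff_zero_eq_constantCoeff_apply, PowerSeries.coeff_rescale]
    simp
  · rw [PowerSeries.coeff_mul, Finset.Nat.sum_antidiagonal_eq_sum_range_succ_mk]
    simp only [Aser, map_sub, PowerSeries.coeff_C_mul, PowerSeries.coeff_mk, PowerSeries.coeff_C,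
      PowerSeries.coeff_rescale, PowerSeries.coeff_exp]
    rw [mul_left_comm, refE_rec, Finset.mul_sum]
    simp only [Nat.succ_ne_zero, if_false]
    rw [sub_zero, sub_zero]
    apply Finset.sum_congr rfl
    intro l hl
    have hl' : l ≤ m + 1 := by simp at hl; omega
    have key : algebraMap ℚ S (1 / ((m + 1).factorial : ℚ)) * ((m + 1).choose l : S) =
        algebraMap ℚ S (1 / (l.factorial : ℚ)) * algebraMap ℚ S (1 / ((m + 1 - l).factorial : ℚ)) := by
      rw [← map_natCast (algebraMap ℚ S), ← map_mul, ← map_mul]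
      congr 1
      rw [Nat.cast_choose ℚ hl']
      have h1 : ((m + 1).factorial : ℚ) ≠ 0 := by positivity
      field_simp
    calc _ = (algebraMap ℚ S (1 / ((m + 1).factorial : ℚ)) * ((m + 1).choose l : S)) *
          (t - 1) ^ l * refE t (m + 1 - l) 0 := by ring
      _ = _ := by rw [key]; ring

lemma rescale_exp_deriv {S : Type*} [CommRing S] [Algebra ℚ S] (s : S) :
    PowerSeries.derivative S (PowerSeries.rescale s (PowerSeries.exp S)) =
      PowerSeries.C s * PowerSeries.rescale s (PowerSeries.exp S) := by
  ext n
  have h := congrArg (PowerSeries.coeff n) (PowerSeries.derivative_exp S)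
  rw [PowerSeries.coeff_derivative] at h
  rw [PowerSeries.coeff_derivative, PowerSeries.coeff_C_mul, PowerSeries.coeff_rescale,
    PowerSeries.coeff_rescale, ← h]
  ring

lemma Aser_deriv {S : Type*} [CommRing S] [IsDomain S] [Algebra ℚ S] (t : S) (ht : t ≠ 1) :
    PowerSeries.derivative S (Aser t) =
      Aser t * (PowerSeries.C t * Aser t - PowerSeries.C (t - 1)) := by
  have h := Aser_eq t
  have hd := congrArg (PowerSeries.derivative S) h
  simp only [map_sub (PowerSeries.derivative S), Derivation.leibniz, PowerSeries.derivative_C,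
    rescale_exp_deriv, smul_eq_mul, mul_zero, add_zero, sub_zero] at hd
  have hne : PowerSeries.C (t - 1) ≠ 0 := by
    intro h0
    have := congrArg PowerSeries.constantCoeff h0
    simp [sub_eq_zero] at this
    exact ht this
  apply mul_left_cancel₀ hne
  set A := Aser t
  set e := PowerSeries.rescale (t - 1) (PowerSeries.exp S)
  linear_combination (Aser t) * hd - (PowerSeries.derivative S A) * h
    - (PowerSeries.C (t-1) * A) * h

lemma linear_ode_unique {S : Type*} [CommRing S] [IsDomain S] [CharZero S] (g Y : PowerSeries S)
    (h : PowerSeries.derivative S Y = g * Y) (h0 : PowerSeries.constantCoeff Y = 0) : Y = 0 := by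
  ext n
  rw [map_zero]
  induction n using Nat.strong_induction_on with
  | _ n ih =>
    rcases n with _ | n
    · simpa using h0
    · have := congrArg (PowerSeries.coeff n) h
      rw [PowerSeries.coeff_derivative, PowerSeries.coeff_mul, Finset.sum_eq_zero] at this
      · exact (mul_eq_zero.mp this).resolve_right (by exact_mod_cast Nat.succ_ne_zero n)
      · intro p hp
        rw [ih p.2 (by have := Finset.HasAntidiagonal.mem_antidiagonal.mp hp; omega), mul_zero]

lemma const_subst {S : Type*} [CommRing S] (f q : PowerSeries S)
    (hq : PowerSeries.constantCoeff q = 0) :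
    PowerSeries.constantCoeff (f.subst q) = PowerSeries.constantCoeff f := by
  have hs : PowerSeries.HasSubst q := PowerSeries.HasSubst.of_constantCoeff_zero' hq
  have h : f = PowerSeries.C (PowerSeries.constantCoeff f) +
      (f - PowerSeries.C (PowerSeries.constantCoeff f)) := by ring
  have h2 : PowerSeries.constantCoeff
      ((f - PowerSeries.C (PowerSeries.constantCoeff f)).subst q) = 0 :=
    PowerSeries.constantCoeff_subst_eq_zero hq _ (by simp)
  conv_lhs => rw [h]
  rw [PowerSeries.subst_add hs, map_add, h2, add_zero, PowerSeries.subst_C]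
  exact PowerSeries.constantCoeff_C _

/-- coefficients of `Q` -/
def qc {S : Type*} [CommRing S] [Algebra ℚ S] {k : ℕ} (t : S) (x : Fin k → S) (r : ℕ) : S :=
  algebraMap ℚ S ((-1) ^ (r - 1) / r) * ((∑ j ∈ Finset.range r, t ^ j) * ∑ i, x i ^ r)

/-- the series `Q` -/
def Qser {S : Type*} [CommRing S] [Algebra ℚ S] {k : ℕ} (t : S) (x : Fin k → S) : PowerSeries S :=
  PowerSeries.mk (qc t x)

lemma Qser_const {S : Type*} [CommRing S] [Algebra ℚ S] {k : ℕ} (t : S) (x : Fin k → S) :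
    PowerSeries.constantCoeff (Qser t x) = 0 := by
  rw [← PowerSeries.coeff_zero_eq_constantCoeff_apply]
  simp [Qser, qc]

lemma Qser_deriv {S : Type*} [CommRing S] [Algebra ℚ S] {k : ℕ} (t : S) (x : Fin k → S) :
    PowerSeries.derivative S (Qser t x) = PowerSeries.mk fun r =>
      (-1) ^ r * ((∑ j ∈ Finset.range (r + 1), t ^ j) * ∑ i, x i ^ (r + 1)) := by
  ext r
  rw [PowerSeries.coeff_derivative, Qser, PowerSeries.coeff_mk, PowerSeries.coeff_mk, qc]
  have : algebraMap ℚ S ((-1) ^ (r + 1 - 1) / (r + 1 : ℕ)) * ((r : S) + 1) = (-1) ^ r := by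
    have h : ((r : S) + 1) = algebraMap ℚ S ((r + 1 : ℕ) : ℚ) := by simp
    rw [h, ← map_mul, Nat.add_sub_cancel, div_mul_cancel₀ _ (by positivity)]
    simp
  rw [← this]; ring

lemma Qser_Pser {S : Type*} [CommRing S] [Algebra ℚ S] {k : ℕ} (t : S) (x : Fin k → S) :
    Pser x + PowerSeries.C (t - 1) * PowerSeries.derivative S (Qser t x) =
      Pser (fun i => t * x i) := by
  rw [Qser_deriv]
  ext r
  rw [map_add, PowerSeries.coeff_C_mul]
  simp only [Pser, PowerSeries.coeff_mk, mul_pow, ← Finset.mul_sum]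
  have := geom_sum_mul t (r + 1)
  linear_combination ((-1) ^ r * ∑ i, x i ^ (r + 1)) * this

lemma trace_series {S : Type*} [CommRing S] [IsDomain S] [Algebra ℚ S] [CharZero S]
    {k : ℕ} (t : S) (ht : t ≠ 1) (x : Fin k → S) :
    (PowerSeries.mk fun n => ((trM t x) ^ (n + 1)).trace) =
      PowerSeries.derivative S (Qser t x) *
        (PowerSeries.C t * (Aser t).subst (Qser t x) - PowerSeries.C (t - 1)) - Pser x := by
  set Q := Qser t x with hQ
  have hs : PowerSeries.HasSubst Q := PowerSeries.HasSubst.of_constantCoeff_zero' (Qser_const t x)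
  set e := PowerSeries.rescale (t - 1) (PowerSeries.exp S) with he
  set F : PowerSeries S := (Aser t).subst Q with hF
  set V : PowerSeries S := e.subst Q with hV
  have subC : ∀ r : S, (PowerSeries.C r).subst Q = PowerSeries.C r := fun r =>
    PowerSeries.subst_C r
  have h1 : PowerSeries.C t * F - PowerSeries.C (t - 1) = V * F := by
    have := congrArg (PowerSeries.subst Q) (Aser_eq t)
    rwa [PowerSeries.subst_sub hs, PowerSeries.subst_mul hs, PowerSeries.subst_mul hs,
      subC, subC] at this
  have h2 : PowerSeries.derivative S F = F * (PowerSeries.C t * F - PowerSeries.C (t - 1)) *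
      PowerSeries.derivative S Q := by
    rw [hF, PowerSeries.derivative_subst hs, Aser_deriv t ht, PowerSeries.subst_mul hs,
      PowerSeries.subst_sub hs, PowerSeries.subst_mul hs, subC, subC]
  have h3 : PowerSeries.derivative S V = PowerSeries.C (t - 1) * V * PowerSeries.derivative S Q := by
    rw [hV, PowerSeries.derivative_subst hs, he, rescale_exp_deriv, PowerSeries.subst_mul hs, subC]
  have hP := Qser_Pser t x
  rw [← hQ] at hP
  have h4 : Eser x * V = Eser (fun i => t * x i) := by
    rw [← sub_eq_zero]
    apply linear_ode_unique (Pser (fun i => t * x i))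
    · rw [map_sub, Derivation.leibniz, h3, Eser_deriv, Eser_deriv, ← hP, smul_eq_mul, smul_eq_mul]
      ring
    · rw [map_sub, map_mul, Eser_const, Eser_const, hV, const_subst _ _ (Qser_const t x), he]
      rw [← PowerSeries.coeff_zero_eq_constantCoeff_apply, PowerSeries.coeff_rescale]
      simp
  have h5 := det_trM t x
  have h6 := resM_det_deriv (trM t x)
  have hDc := resM_det_const (trM t x)
  set D := (resM (trM t x)).det
  set T := PowerSeries.mk fun n => ((trM t x) ^ (n + 1)).trace
  have hne : PowerSeries.C (t - 1) ≠ 0 := by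
    intro h0
    have := congrArg PowerSeries.constantCoeff h0
    simp [sub_eq_zero] at this
    exact ht this
  have h7 : D * F = Eser x := by
    apply mul_left_cancel₀ hne
    rw [map_sub, map_one] at h1 ⊢
    linear_combination F * h5 + F * h4 + Eser x * h1
  have hEd := Eser_deriv x
  have hD0 : D ≠ 0 := by
    intro h0; rw [h0] at hDc; simp at hDc
  have hF0 : F ≠ 0 := by
    intro h0
    have := Eser_const x
    rw [← h7, h0] at this; simp at this
  apply mul_left_cancel₀ hD0
  apply mul_left_cancel₀ hF0
  rw [← h7, Derivation.leibniz, h6, h2, smul_eq_mul, smul_eq_mul] at hEd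
  linear_combination -hEd

lemma countPerms_rat [DecidableEq ℕ] (s : Multiset ℕ) :
    (1 / (s.card.factorial : ℚ)) * (s.countPerms : ℚ) =
      1 / ((∏ i ∈ s.toFinset, (s.count i).factorial : ℕ) : ℚ) := by
  have h := Nat.multinomial_spec s.toFinset (fun i => s.count i)
  rw [Multiset.toFinset_sum_count_eq] at h
  have h2 : s.countPerms = Nat.multinomial s.toFinset (fun i => s.count i) := by
    rw [Multiset.countPerms, Finsupp.multinomial_eq, Multiset.toFinsupp_support]
    rfl
  rw [h2]
  have h3 : ((∏ i ∈ s.toFinset, (s.count i).factorial : ℕ) : ℚ) ≠ 0 := by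
    have : 0 < ∏ i ∈ s.toFinset, (s.count i).factorial :=
      Finset.prod_pos fun i _ => Nat.factorial_pos _
    exact_mod_cast this.ne'
  have h4 : (s.card.factorial : ℚ) ≠ 0 := by positivity
  rw [eq_div_iff h3, ← h]
  rw [← h] at h4
  rw [Nat.cast_mul] at h4 ⊢
  rw [one_div, inv_mul_eq_div, div_mul_eq_mul_div, mul_comm, div_self h4]

lemma prod_map_term {S : Type*} [CommRing S] (q : ℕ → S) (s : Multiset ℕ) :
    (s.map fun r => (PowerSeries.X ^ r * PowerSeries.C (q r) : PowerSeries S)).prod =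
      PowerSeries.X ^ s.sum * PowerSeries.C (s.map q).prod := by
  induction s using Multiset.induction_on with
  | empty => simp
  | cons a s ih => simp [ih, pow_add]; ring

lemma coeff_pow_congr {S : Type*} [CommRing S] (f g : PowerSeries S) (n m : ℕ)
    (h : ∀ r ≤ n, PowerSeries.coeff r f = PowerSeries.coeff r g) :
    PowerSeries.coeff n (f ^ m) = PowerSeries.coeff n (g ^ m) := by
  rw [PowerSeries.coeff_pow, PowerSeries.coeff_pow]
  apply Finset.sum_congr rfl
  intro l hl
  apply Finset.prod_congr rfl
  intro i hi
  apply h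
  rw [Finset.mem_finsuppAntidiag] at hl
  rw [← hl.1]
  exact Finset.single_le_sum (fun _ _ => Nat.zero_le _) hi

lemma coeff_pow_partition {S : Type*} [CommRing S] [Algebra ℚ S] (q : ℕ → S) (hq : q 0 = 0)
    (n m : ℕ) :
    algebraMap ℚ S (1 / (m.factorial : ℚ)) * PowerSeries.coeff n ((PowerSeries.mk q) ^ m) =
      ∑ μ ∈ Finset.univ.filter (fun μ : n.Partition => μ.parts.card = m),
        algebraMap ℚ S (1 / ((∏ i ∈ μ.parts.toFinset, (μ.parts.count i).factorial : ℕ) : ℚ)) *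
          (μ.parts.map q).prod := by
  rw [coeff_pow_congr _ (∑ r ∈ Finset.Icc 1 n, PowerSeries.X ^ r * PowerSeries.C (q r))]
  swap
  · intro r hr
    rw [PowerSeries.coeff_mk, map_sum]
    simp only [PowerSeries.coeff_mul_C, PowerSeries.coeff_X_pow]
    rcases Nat.eq_zero_or_pos r with rfl | hr0
    · rw [hq]
      symm
      apply Finset.sum_eq_zero
      intro i hi
      have : 0 ≠ i := by simp at hi; omega
      simp [this]
    · rw [Finset.sum_eq_single r]
      · simp
      · intro b _ hb
        simp [hb.symm]
      · intro h; simp at h; omega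
  rw [Finset.sum_pow, map_sum, Finset.mul_sum]
  simp only [prod_map_term]
  have hterm : ∀ s : Sym ℕ m, algebraMap ℚ S (1 / (m.factorial : ℚ)) * PowerSeries.coeff n
      (((s.val.countPerms : ℕ) : PowerSeries S) *
        (PowerSeries.X ^ s.val.sum * PowerSeries.C (s.val.map q).prod)) =
      if s.val.sum = n then
        algebraMap ℚ S (1 / ((∏ i ∈ s.val.toFinset, (s.val.count i).factorial : ℕ) : ℚ)) *
          (s.val.map q).prod else 0 := by
    intro s
    rw [← map_natCast (PowerSeries.C (R := S)), PowerSeries.coeff_C_mul, PowerSeries.coeff_mul_C,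
      PowerSeries.coeff_X_pow]
    by_cases h : s.val.sum = n
    · rw [if_pos h.symm, if_pos h, ← countPerms_rat, s.prop, map_mul, map_natCast]
      ring
    · rw [if_neg (fun h' => h h'.symm), if_neg h]; ring
  rw [Finset.sum_congr rfl (fun s _ => hterm s), ← Finset.sum_filter]
  symm
  refine Finset.sum_bij
    (fun μ hμ => (⟨μ.parts, (Finset.mem_filter.mp hμ).2⟩ : Sym ℕ m)) ?_ ?_ ?_ ?_
  · intro μ hμ
    refine Finset.mem_filter.mpr ⟨Finset.mem_sym_iff.mpr (fun a ha => ?_), μ.parts_sum⟩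
    have ha' : a ∈ μ.parts := ha
    rw [Finset.mem_Icc]
    refine ⟨μ.parts_pos ha', ?_⟩
    have := Multiset.single_le_sum (fun x _ => Nat.zero_le x) a ha'
    rwa [μ.parts_sum] at this
  · intro μ _ ν _ h
    have := congrArg Subtype.val h
    exact Nat.Partition.ext this
  · intro s hs
    rw [Finset.mem_filter, Finset.mem_sym_iff] at hs
    refine ⟨⟨s.val, fun {a} ha => ?_, hs.2⟩, ?_, rfl⟩
    · have := hs.1 a ha
      rw [Finset.mem_Icc] at this
      exact this.1
    · rw [Finset.mem_filter]
      exact ⟨Finset.mem_univ _, s.prop⟩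
  · intro μ _
    rfl

/-- series whose derivative is `Aser - 1` -/
def Hser {S : Type*} [CommRing S] [Algebra ℚ S] (t : S) : PowerSeries S :=
  PowerSeries.mk fun m => if m ≤ 1 then 0 else
    refE t (m - 1) 0 * algebraMap ℚ S (1 / (m.factorial : ℚ))

lemma Hser_deriv {S : Type*} [CommRing S] [Algebra ℚ S] (t : S) :
    PowerSeries.derivative S (Hser t) = Aser t - 1 := by
  ext m
  rw [PowerSeries.coeff_derivative, map_sub, Hser, Aser, PowerSeries.coeff_mk, PowerSeries.coeff_mk,
    PowerSeries.coeff_one]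
  rcases m with _ | m
  · simp [refE]
  · have h : ¬ (m + 1 + 1 ≤ 1) := by omega
    rw [if_neg h, if_neg (Nat.succ_ne_zero m), sub_zero, Nat.add_sub_cancel]
    have h : (((m + 1 : ℕ) : S) + 1) = algebraMap ℚ S ((m + 1 + 1 : ℕ) : ℚ) := by simp
    rw [h, mul_assoc, ← map_mul, mul_comm]
    congr 2
    rw [Nat.factorial_succ (m + 1)]
    have : ((m + 1).factorial : ℚ) ≠ 0 := by positivity
    have h2 : ((m + 1 + 1 : ℕ) : ℚ) ≠ 0 := by positivity
    rw [Nat.cast_mul]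
    field_simp

lemma coeff_H {S : Type*} [CommRing S] [Algebra ℚ S] {k : ℕ} (t : S) (x : Fin k → S) (n : ℕ) :
    PowerSeries.coeff n ((Hser t).subst (Qser t x)) =
      ∑ μ : n.Partition, if μ.parts.card ≤ 1 then 0 else refE t (μ.parts.card - 1) 0 *
        (algebraMap ℚ S (1 / ((∏ i ∈ μ.parts.toFinset, (μ.parts.count i).factorial : ℕ) : ℚ)) *
          (μ.parts.map (qc t x)).prod) := by
  have hs : PowerSeries.HasSubst (Qser t x) :=
    PowerSeries.HasSubst.of_constantCoeff_zero' (Qser_const t x)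
  have hq : qc t x 0 = 0 := by simp [qc]
  have hcard : ∀ μ : n.Partition, μ.parts.card ≤ n := by
    intro μ
    have := Multiset.card_nsmul_le_sum (s := μ.parts) (a := 1) (fun a ha => μ.parts_pos ha)
    rw [μ.parts_sum] at this
    simpa using this
  rw [PowerSeries.coeff_subst' hs]
  have hterm : ∀ d, PowerSeries.coeff d (Hser t) • PowerSeries.coeff n (Qser t x ^ d) =
      ∑ μ : n.Partition, if μ.parts.card = d then
        (if μ.parts.card ≤ 1 then 0 else refE t (μ.parts.card - 1) 0 *
        (algebraMap ℚ S (1 / ((∏ i ∈ μ.parts.toFinset, (μ.parts.count i).factorial : ℕ) : ℚ)) *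
          (μ.parts.map (qc t x)).prod)) else 0 := by
    intro d
    rw [smul_eq_mul, Hser, PowerSeries.coeff_mk, ← Finset.sum_filter]
    by_cases hd : d ≤ 1
    · rw [if_pos hd, zero_mul]
      symm
      apply Finset.sum_eq_zero
      intro μ hμ
      rw [(Finset.mem_filter.mp hμ).2, if_pos hd]
    · rw [if_neg hd, mul_assoc, Qser, coeff_pow_partition _ hq, Finset.mul_sum]
      apply Finset.sum_congr rfl
      intro μ hμ
      rw [(Finset.mem_filter.mp hμ).2, if_neg hd]
  simp only [hterm]
  rw [finsum_eq_sum_of_support_subset (s := Finset.range (n + 1))]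
  · rw [Finset.sum_comm]
    apply Finset.sum_congr rfl
    intro μ _
    rw [Finset.sum_ite_eq, if_pos]
    simp
    have := hcard μ
    omega
  · intro d hd
    by_contra hnd
    apply hd
    apply Finset.sum_eq_zero
    intro μ _
    rw [if_neg]
    intro h
    apply hnd
    have := hcard μ
    simp
    omega

lemma zlam_rat {n : ℕ} (μ : n.Partition) :
    (1 / ((∏ i ∈ μ.parts.toFinset, (μ.parts.count i).factorial : ℕ) : ℚ)) *
      (μ.parts.map (fun r : ℕ => ((-1 : ℚ) ^ (r - 1) / r))).prod =
        (-1 : ℚ) ^ (n - μ.parts.card) / (zlam μ : ℚ) := by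
  have hsign : ∀ s : Multiset ℕ, (∀ a ∈ s, 0 < a) → s.card ≤ s.sum ∧
      (s.map (fun r : ℕ => (-1 : ℚ) ^ (r - 1))).prod = (-1) ^ (s.sum - s.card) := by
    intro s
    induction s using Multiset.induction_on with
    | empty => simp
    | cons a s ih =>
      intro h
      obtain ⟨h1, h2⟩ := ih (fun b hb => h b (Multiset.mem_cons_of_mem hb))
      have ha := h a (Multiset.mem_cons_self a s)
      rw [Multiset.map_cons, Multiset.prod_cons, Multiset.sum_cons, Multiset.card_cons, h2,
        ← pow_add]
      refine ⟨by omega, ?_⟩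
      congr 1
      omega
  have hs := (hsign μ.parts (fun a ha => μ.parts_pos ha)).2
  rw [μ.parts_sum] at hs
  rw [Multiset.prod_map_div, hs, zlam, Finset.prod_mul_distrib]
  have : (μ.parts.map (fun r : ℕ => (r : ℚ))).prod =
      ((∏ i ∈ μ.parts.toFinset, i ^ μ.parts.count i : ℕ) : ℚ) := by
    rw [← Finset.prod_multiset_count, Nat.cast_multiset_prod]
  rw [this, Nat.cast_mul, div_mul_div_comm, one_mul, mul_comm ((_ : ℕ) : ℚ)]

lemma prod_map_three {S : Type*} [CommRing S] [Algebra ℚ S] (s : Multiset ℕ) (f : ℕ → S)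
    (a : ℕ → ℚ) (b c : ℕ → S) (h : ∀ r, f r = algebraMap ℚ S (a r) * (b r * c r)) :
    (s.map f).prod = algebraMap ℚ S (s.map a).prod * ((s.map b).prod * (s.map c).prod) := by
  induction s using Multiset.induction_on with
  | empty => simp
  | cons r s ih =>
    rw [Multiset.map_cons, Multiset.map_cons, Multiset.map_cons, Multiset.map_cons,
      Multiset.prod_cons, Multiset.prod_cons, Multiset.prod_cons, Multiset.prod_cons, ih, h, map_mul]
    ring

/-- `W̃_n^≠(x,t) = Σ_{λ ⊢ n} (-1)^{n-ℓ(λ)} c̃_λ(t) p_λ(x)/z_λ`. -/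
theorem cyclic_smirnov_ne_power_sum_expansion (n k : ℕ) (hn : 1 ≤ n) (hk : 1 ≤ k) :
    smirnovEnum ℚ n k cdesc FirstNeLast =
      ∑ μ : n.Partition, ((-1 : ℚ) ^ (n - μ.parts.card) / (zlam μ : ℚ)) •
        (cne k n μ * Polynomial.C (psumPart (Fin k) ℚ μ)) := by
  obtain ⟨N, rfl⟩ : ∃ N, n = N + 1 := ⟨n - 1, by omega⟩
  set t : Polynomial (MvPolynomial (Fin k) ℚ) := Polynomial.X with ht
  set x : Fin k → Polynomial (MvPolynomial (Fin k) ℚ) :=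
    fun i => Polynomial.C (MvPolynomial.X i) with hx
  have ht1 : t ≠ 1 := by
    intro h
    have := congrArg (fun p => Polynomial.coeff p 1) h
    simp [ht, Polynomial.coeff_one] at this
  have hs : PowerSeries.HasSubst (Qser t x) :=
    PowerSeries.HasSubst.of_constantCoeff_zero' (Qser_const t x)
  have htr := congrArg (PowerSeries.coeff N) (trace_series t ht1 x)
  rw [PowerSeries.coeff_mk] at htr
  rw [smirnov_eq_trace, htr]
  have hone : (1 : PowerSeries (Polynomial (MvPolynomial (Fin k) ℚ))).subst (Qser t x) = 1 := by
    have := PowerSeries.subst_C (a := Qser t x) (1 : Polynomial (MvPolynomial (Fin k) ℚ))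
    rw [map_one, map_one] at this
    exact this
  have hsplit : PowerSeries.derivative _ (Qser t x) *
        (PowerSeries.C t * (Aser t).subst (Qser t x) - PowerSeries.C (t - 1)) - Pser x =
      PowerSeries.C t * PowerSeries.derivative _ ((Hser t).subst (Qser t x)) +
        (PowerSeries.derivative _ (Qser t x) - Pser x) := by
    rw [PowerSeries.derivative_subst hs, Hser_deriv, PowerSeries.subst_sub hs, hone, map_sub,
      map_one]
    ring
  have hp : ∀ r : ℕ, ∑ i, x i ^ r = Polynomial.C (psum (Fin k) ℚ r) := by
    intro r
    simp [psum, hx]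
  rw [hsplit, map_add, PowerSeries.coeff_C_mul, PowerSeries.coeff_derivative, coeff_H, map_sub,
    Qser_deriv, Pser, PowerSeries.coeff_mk, PowerSeries.coeff_mk]
  have hsm : ∀ (a : ℚ) (b : Polynomial (MvPolynomial (Fin k) ℚ)),
      a • b = algebraMap ℚ _ a * b := fun a b => Algebra.smul_def a b
  set ind : (N + 1).Partition := Nat.Partition.indiscrete (N + 1) with hind
  have hindp : ind.parts = {N + 1} := by simp [hind]
  have hcard1 : ∀ μ : (N + 1).Partition, μ.parts.card ≤ 1 ↔ μ = ind := by
    intro μ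
    constructor
    · intro h
      have h0 : μ.parts.card ≠ 0 := by
        intro h0
        rw [Multiset.card_eq_zero] at h0
        have := μ.parts_sum
        rw [h0] at this
        simp at this
      obtain ⟨a, ha⟩ := Multiset.card_eq_one.mp (by omega : μ.parts.card = 1)
      have hsum := μ.parts_sum
      rw [ha, Multiset.sum_singleton] at hsum
      apply Nat.Partition.ext
      rw [ha, hindp, hsum]
    · rintro rfl
      simp [hindp]
  rw [← Finset.add_sum_erase _ _ (Finset.mem_univ ind),
    ← Finset.add_sum_erase _ (fun μ : (N + 1).Partition =>
      ((-1 : ℚ) ^ (N + 1 - μ.parts.card) / (zlam μ : ℚ)) •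
        (cne k (N + 1) μ * Polynomial.C (psumPart (Fin k) ℚ μ))) (Finset.mem_univ ind),
    if_pos ((hcard1 ind).mpr rfl), zero_add, add_comm]
  congr 1
  · rw [hsm, ← zlam_rat, cne, if_pos (by simp [hindp]), psumPart, hindp]
    simp only [Multiset.map_singleton, Multiset.prod_singleton, hp, tnum, ← ht]
    have hc1 : (∏ i ∈ ({N + 1} : Multiset ℕ).toFinset,
        (({N + 1} : Multiset ℕ).count i).factorial) = 1 := by
      simp
    rw [hc1, Finset.sum_range_succ', Nat.add_sub_cancel]
    have hq : algebraMap ℚ (Polynomial (MvPolynomial (Fin k) ℚ))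
        (1 / ((1 : ℕ) : ℚ) * ((-1) ^ N / ((N + 1 : ℕ) : ℚ))) *
          ((N + 1 : ℕ) : Polynomial (MvPolynomial (Fin k) ℚ)) = (-1) ^ N := by
      rw [← map_natCast (algebraMap ℚ (Polynomial (MvPolynomial (Fin k) ℚ))) (N + 1), ← map_mul,
        Nat.cast_one, div_one, one_mul, div_mul_cancel₀ _ (by positivity)]
      simp
    have hg : ∑ j ∈ Finset.range N, t ^ (j + 1) = t * ∑ j ∈ Finset.range N, t ^ j := by
      rw [Finset.mul_sum]
      exact Finset.sum_congr rfl (fun j _ => pow_succ' t j)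
    rw [hg, pow_zero]
    revert hq
    generalize algebraMap ℚ (Polynomial (MvPolynomial (Fin k) ℚ))
        (1 / ((1 : ℕ) : ℚ) * ((-1) ^ N / ((N + 1 : ℕ) : ℚ))) = A
    generalize ((N + 1 : ℕ) : Polynomial (MvPolynomial (Fin k) ℚ)) = B
    generalize (∑ j ∈ Finset.range N, t ^ j) = D
    intro hq
    linear_combination (-(t * D * Polynomial.C (psum (Fin k) ℚ (N + 1)))) * hq
  · rw [Finset.sum_mul, Finset.mul_sum]
    apply Finset.sum_congr rfl
    intro μ hμ
    have hc : ¬ μ.parts.card ≤ 1 := by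
      rw [hcard1]; exact Finset.ne_of_mem_erase hμ
    rw [if_neg hc, hsm, ← zlam_rat, cne, if_neg (by omega), psumPart, Eul_eq_refE, map_mul]
    have hprod : (μ.parts.map (qc t x)).prod =
        algebraMap ℚ _ (μ.parts.map (fun r : ℕ => ((-1 : ℚ) ^ (r - 1) / r))).prod *
          ((μ.parts.map (tnum ℚ k)).prod * Polynomial.C (μ.parts.map (psum (Fin k) ℚ)).prod) := by
      rw [map_multiset_prod (Polynomial.C), Multiset.map_map]
      refine prod_map_three _ _ _ _ _ (fun r => ?_)
      rw [qc, hp, ht]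
      rfl
    rw [hprod]
    generalize (μ.parts.map (tnum ℚ k)).prod = a1
    generalize Polynomial.C (μ.parts.map (psum (Fin k) ℚ)).prod = a2
    generalize algebraMap ℚ (Polynomial (MvPolynomial (Fin k) ℚ))
      (μ.parts.map (fun r : ℕ => ((-1 : ℚ) ^ (r - 1) / r))).prod = a3
    generalize algebraMap ℚ (Polynomial (MvPolynomial (Fin k) ℚ))
      (1 / ((∏ i ∈ μ.parts.toFinset, (μ.parts.count i).factorial : ℕ) : ℚ)) = a4
    generalize refE t (μ.parts.card - 1) 0 = a5
    rw [Nat.cast_add, Nat.cast_one]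
    ring

end
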